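/- Let (γ/β, ρ) be an affine set-valued strip and let i be the residue of the rightmost cell of γ/ρ. If i ∈ Res(γ/β), then (γ̂/β, ρ) is an affine set-valued strip, where γ̂ is γ with all its removable i-corners deleted. Otherwise, (γ/β, ρ̂) is an affine set-valued strip, where ρ̂ is ρ together with all its addable i-corners. -/

import Mathlib

open scoped Classical

namespace AffineKTheory

noncomputable instance : Nonempty YoungDiagram := ⟨⊥⟩

noncomputable instance : Nonempty YoungDiagram := ⟨⊥⟩

/-! ## Cells, hooks, cores, residues -/

/-- Hook length of the cell `(r, c)` in the diagram `γ`. -/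
def hookLen (γ : YoungDiagram) (r c : ℕ) : ℕ :=
  (γ.rowLen r - c) + (γ.colLen c - r) - 1

/-- A `p`-core: a diagram none of whose cells has hook length `p`. -/
def IsCore (p : ℕ) (γ : YoungDiagram) : Prop :=
  ∀ c : ℕ × ℕ, c ∈ γ → hookLen γ c.1 c.2 ≠ p

/-- The `(k+1)`-residue of a cell.  (Rows of the Ferrers shape are indexed so that the cell
directly above `(r, c)` -- in the Ferrers sense of the next, shorter, row -- is `(r+1, c)`.) -/
def residue (k : ℕ) (c : ℕ × ℕ) : ZMod (k + 1) :=
  (c.2 : ZMod (k + 1)) - (c.1 : ZMod (k + 1))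

/-- A removable corner of `γ`: a cell of `γ` with no cell above it nor to its right. -/
def Removable (γ : YoungDiagram) (c : ℕ × ℕ) : Prop :=
  c ∈ γ ∧ (c.1 + 1, c.2) ∉ γ ∧ (c.1, c.2 + 1) ∉ γ

/-- An addable corner of `γ`: a cell outside `γ` whose addition again yields a partition shape. -/
def Addable (γ : YoungDiagram) (c : ℕ × ℕ) : Prop :=
  c ∉ γ ∧ ∀ d : ℕ × ℕ, d ≤ c → d ≠ c → d ∈ γ

/-- A cell is `γ`-blocked if it lies below a cell of `γ`. -/
def Blocked (γ : YoungDiagram) (c : ℕ × ℕ) : Prop :=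
  (c.1 + 1, c.2) ∈ γ

/-- The number of cells of `γ` in row `i` whose hook length is at most `k`:
the `i`-th part of `𝔭(γ)`. -/
noncomputable def pRow (k : ℕ) (γ : YoungDiagram) (i : ℕ) : ℕ :=
  (γ.cells.filter (fun c => c.1 = i ∧ hookLen γ c.1 c.2 ≤ k)).card

/-- The number of cells of `γ` with `k`-bounded hook length, i.e. `|𝔭(γ)|`. -/
noncomputable def pSize (k : ℕ) (γ : YoungDiagram) : ℕ :=
  (γ.cells.filter (fun c => hookLen γ c.1 c.2 ≤ k)).card

/-- A `k`-bounded partition: all parts at most `k`. -/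
def IsKBounded (k : ℕ) (lam : YoungDiagram) : Prop :=
  ∀ i, lam.rowLen i ≤ k

/-- `𝔭(γ)`: the `k`-bounded partition obtained from a `(k+1)`-core `γ` by deleting every cell of
hook length greater than `k` and reading off row lengths. -/
noncomputable def pPart (k : ℕ) (γ : YoungDiagram) : YoungDiagram :=
  Classical.epsilon fun lam => ∀ i, lam.rowLen i = pRow k γ i

/-- `𝔠(λ)`: the unique `(k+1)`-core corresponding to the `k`-bounded partition `λ` under the
bijection `𝔭`. -/
noncomputable def coreOf (k : ℕ) (lam : YoungDiagram) : YoungDiagram :=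
  Classical.epsilon fun γ => IsCore (k + 1) γ ∧ ∀ i, pRow k γ i = lam.rowLen i

/-- The `k`-conjugate `λ^{ω_k} = 𝔭(𝔠(λ)')` of a `k`-bounded partition. -/
noncomputable def kConj (k : ℕ) (lam : YoungDiagram) : YoungDiagram :=
  pPart k ((coreOf k lam).transpose)

/-- A `k`-bounded composition: a list of parts, each between `1` and `k`. -/
def IsKBoundedComp (k : ℕ) (α : List ℕ) : Prop :=
  ∀ a ∈ α, 1 ≤ a ∧ a ≤ k

/-- Dominance order on partitions. -/
def Dominates (mu lam : YoungDiagram) : Prop :=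
  mu.card = lam.card ∧
    ∀ n : ℕ, ∑ i ∈ Finset.range n, lam.rowLen i ≤ ∑ i ∈ Finset.range n, mu.rowLen i


/-! ## Strips -/

/-- `γ/β` is a horizontal strip: `β ⊆ γ` with at most one cell of `γ/β` in each column. -/
def IsHorizontalStrip (β γ : YoungDiagram) : Prop :=
  β ≤ γ ∧ ∀ c d : ℕ × ℕ, c ∈ γ → c ∉ β → d ∈ γ → d ∉ β → c.2 = d.2 → c = d

/-- `Res(γ/β)`: the set of residues of the cells of `γ/β`. -/
noncomputable def resSet (k : ℕ) (β γ : YoungDiagram) : Finset (ZMod (k + 1)) :=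
  (γ.cells \ β.cells).image (residue k)

/-- An affine `r`-strip `γ/β` (for `0 ≤ r ≤ k`): a horizontal strip of `(k+1)`-cores with
`|𝔭(γ)| = |𝔭(β)| + r` occupying exactly `r` distinct residues. -/
def IsAffineStrip (k r : ℕ) (β γ : YoungDiagram) : Prop :=
  r ≤ k ∧ IsCore (k + 1) β ∧ IsCore (k + 1) γ ∧ IsHorizontalStrip β γ ∧
  pSize k γ = pSize k β + r ∧ (resSet k β γ).card = r

/-- An affine set-valued `r`-strip `(γ/β, ρ)` (for `0 ≤ r ≤ k`), with `(k+1)`-cores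
`ρ ⊆ β ⊆ γ`:  (asv1) `γ/ρ` is a horizontal strip; (asv2) `γ/β` is an affine `(r-m)`-strip
where `m = |Res(β/ρ)|`; (asv3) `β/ρ` consists of `β`-removable corners, and if a cell of
residue `i` lies in `β/ρ` then every `β`-removable `i`-corner that is not `γ`-blocked lies
in `β/ρ`. -/
def IsAffineSVStrip (k r : ℕ) (ρ β γ : YoungDiagram) : Prop :=
  r ≤ k ∧ IsCore (k + 1) ρ ∧ ρ ≤ β ∧
  IsHorizontalStrip ρ γ ∧
  (resSet k ρ β).card ≤ r ∧
  IsAffineStrip k (r - (resSet k ρ β).card) β γ ∧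
  (∀ c : ℕ × ℕ, c ∈ β → c ∉ ρ → Removable β c) ∧
  (∀ c : ℕ × ℕ, c ∈ β → c ∉ ρ → ∀ c' : ℕ × ℕ, Removable β c' →
    residue k c' = residue k c → ¬ Blocked γ c' → c' ∉ ρ)

/-- The finite set of addable corners of `γ` with residue `i`. -/
noncomputable def addableSet (k : ℕ) (i : ZMod (k + 1)) (γ : YoungDiagram) : Finset (ℕ × ℕ) :=
  ((Finset.range (γ.colLen 0 + 1)).image fun r => (r, γ.rowLen r)).filter
    fun c => Addable γ c ∧ residue k c = i

/-- The operator `𝔰_i`: add to `γ` all its addable corners of residue `i`. -/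
noncomputable def addCorners (k : ℕ) (i : ZMod (k + 1)) (γ : YoungDiagram) : YoungDiagram where
  cells := γ.cells ∪ addableSet k i γ
  isLowerSet := by
    intro a b hba ha
    simp only [Finset.coe_union, Set.mem_union, Finset.mem_coe] at ha ⊢
    rcases ha with ha | ha
    · exact Or.inl (γ.isLowerSet hba ha)
    · have haddable : Addable γ a := ((Finset.mem_filter.mp ha).2).1
      by_cases hab : b = a
      · exact Or.inr (hab ▸ ha)
      · exact Or.inl (haddable.2 b hba hab)



/-! ## The edge sequence of a diagram -/

theorem exists_not_mem_diagonal (γ : YoungDiagram) (t : ℤ) :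
    ∃ r : ℕ, 0 ≤ r + t ∧ (r, (r + t).toNat) ∉ γ := by
  refine ⟨γ.colLen 0 + t.natAbs, by omega, fun h => ?_⟩
  have h' : (γ.colLen 0 + t.natAbs, 0) ∈ γ := γ.up_left_mem le_rfl (Nat.zero_le _) h
  rw [YoungDiagram.mem_iff_lt_colLen] at h'
  omega

/-- The number of rows of `γ` (including the empty ones) whose end has content at least `t`. -/
noncomputable def rowsFrom (γ : YoungDiagram) (t : ℤ) : ℕ :=
  Nat.find (exists_not_mem_diagonal γ t)

theorem rowsFrom_add_nonneg (γ : YoungDiagram) (t : ℤ) : 0 ≤ rowsFrom γ t + t :=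
  (Nat.find_spec (exists_not_mem_diagonal γ t)).1

theorem mem_iff_lt_rowsFrom (γ : YoungDiagram) (r c : ℕ) :
    (r, c) ∈ γ ↔ r < rowsFrom γ (c - r) := by
  constructor
  · intro h
    by_contra! hle
    obtain ⟨h1, h2⟩ := Nat.find_spec (exists_not_mem_diagonal γ (c - r))
    exact h2 (γ.up_left_mem hle (by change rowsFrom γ (c - r) ≤ r at hle; unfold rowsFrom at hle; omega) h)
  · intro h
    have := Nat.find_min (exists_not_mem_diagonal γ (c - r)) h
    by_contra hn
    refine this ⟨by omega, ?_⟩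
    have e : ((r : ℤ) + (c - r)).toNat = c := by omega
    rwa [e]

theorem lt_rowsFrom_iff (γ : YoungDiagram) (r : ℕ) (t : ℤ) :
    r < rowsFrom γ t ↔ t + r + 1 ≤ γ.rowLen r := by
  have h0 := rowsFrom_add_nonneg γ t
  rcases lt_or_ge (t + r) 0 with h | h
  · constructor <;> intro <;> omega
  · have := mem_iff_lt_rowsFrom γ r (t + r).toNat
    rw [YoungDiagram.mem_iff_lt_rowLen, show (((t + r).toNat : ℕ) : ℤ) - r = t by omega] at this
    rw [← this]
    omega

theorem rowsFrom_step (γ : YoungDiagram) (t : ℤ) :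
    rowsFrom γ (t + 1) ≤ rowsFrom γ t ∧ rowsFrom γ t ≤ rowsFrom γ (t + 1) + 1 := by
  constructor
  · by_contra! h
    rw [lt_rowsFrom_iff] at h
    have := (lt_rowsFrom_iff γ (rowsFrom γ t) t).not.1 (lt_irrefl _)
    omega
  · by_contra! h
    rw [lt_rowsFrom_iff] at h
    have h1 := (lt_rowsFrom_iff γ (rowsFrom γ (t + 1)) (t + 1)).not.1 (lt_irrefl _)
    have h2 := γ.rowLen_anti (rowsFrom γ (t + 1)) (rowsFrom γ (t + 1) + 1) (by omega)
    push_cast at h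
    omega

theorem rowsFrom_antitone (γ : YoungDiagram) : Antitone (rowsFrom γ) := by
  intro s t hst
  by_contra! h
  rw [lt_rowsFrom_iff] at h
  have := (lt_rowsFrom_iff γ (rowsFrom γ s) s).not.1 (lt_irrefl _)
  omega

theorem rowsFrom_rowLen (γ : YoungDiagram) (r : ℕ) :
    rowsFrom γ (γ.rowLen r - r - 1) = r + 1 ∧ rowsFrom γ (γ.rowLen r - r) = r := by
  have h1 := lt_rowsFrom_iff γ r (γ.rowLen r - r - 1)
  have h2 := lt_rowsFrom_iff γ r (γ.rowLen r - r)
  have h3 := rowsFrom_step γ (γ.rowLen r - r - 1)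
  rw [sub_add_cancel] at h3
  omega

theorem rowsFrom_colLen (γ : YoungDiagram) (c : ℕ) :
    rowsFrom γ (c - γ.colLen c) = γ.colLen c ∧
      rowsFrom γ (c - γ.colLen c + 1) = γ.colLen c := by
  have h1 := mem_iff_lt_rowsFrom γ (γ.colLen c) c
  have h3 := rowsFrom_step γ (c - γ.colLen c)
  rw [YoungDiagram.mem_iff_lt_colLen] at h1
  have h2 : γ.colLen c ≤ rowsFrom γ (c - γ.colLen c + 1) := by
    rcases Nat.eq_zero_or_pos (γ.colLen c) with h | h
    · omega
    · have h2 := mem_iff_lt_rowsFrom γ (γ.colLen c - 1) c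
      rw [YoungDiagram.mem_iff_lt_colLen,
        show (c : ℤ) - ((γ.colLen c - 1 : ℕ) : ℤ) = c - γ.colLen c + 1 by omega] at h2
      omega
  omega

theorem rowsFrom_eq_zero (γ : YoungDiagram) (t : ℤ) (h : γ.rowLen 0 ≤ t) :
    rowsFrom γ t = 0 := by
  have := lt_rowsFrom_iff γ 0 t
  push_cast at this
  omega

theorem rowsFrom_eq_neg (γ : YoungDiagram) (t : ℤ) (h : t ≤ -γ.colLen 0) :
    (rowsFrom γ t : ℤ) = -t := by
  have h0 := rowsFrom_add_nonneg γ t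
  have h1 := mem_iff_lt_rowsFrom γ (-t).toNat 0
  rw [YoungDiagram.mem_iff_lt_colLen,
    show ((0 : ℕ) : ℤ) - ((-t).toNat : ℕ) = t by omega] at h1
  omega

/-- The edge sequence of `γ`: `1` at the contents of the ends of the rows, `0` elsewhere. -/
noncomputable def bead (γ : YoungDiagram) (t : ℤ) : ℤ :=
  rowsFrom γ t - rowsFrom γ (t + 1)

theorem bead_eq_zero_or_one (γ : YoungDiagram) (t : ℤ) : bead γ t = 0 ∨ bead γ t = 1 := by
  have := rowsFrom_step γ t
  unfold bead
  omega

theorem hookLen_eq {γ : YoungDiagram} {r c : ℕ} (h : (r, c) ∈ γ) :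
    (hookLen γ r c : ℤ) = (γ.rowLen r - r - 1) - (c - γ.colLen c) := by
  have h1 := YoungDiagram.mem_iff_lt_rowLen.1 h
  have h2 := YoungDiagram.mem_iff_lt_colLen.1 h
  unfold hookLen
  omega

theorem colLen_eq_of_bead_eq_zero {γ : YoungDiagram} {u : ℤ} (h : bead γ u = 0) :
    γ.colLen (u + rowsFrom γ u).toNat = rowsFrom γ u := by
  have h0 := rowsFrom_add_nonneg γ u
  unfold bead at h
  have h1 := mem_iff_lt_rowsFrom γ (rowsFrom γ u) (u + rowsFrom γ u).toNat
  rw [YoungDiagram.mem_iff_lt_colLen,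
    show (((u + rowsFrom γ u).toNat : ℕ) : ℤ) - (rowsFrom γ u : ℕ) = u by omega] at h1
  have h2 : rowsFrom γ u ≤ γ.colLen (u + rowsFrom γ u).toNat := by
    rcases Nat.eq_zero_or_pos (rowsFrom γ u) with h3 | h3
    · omega
    · have h2 := mem_iff_lt_rowsFrom γ (rowsFrom γ u - 1) (u + rowsFrom γ u).toNat
      rw [YoungDiagram.mem_iff_lt_colLen,
        show (((u + rowsFrom γ u).toNat : ℕ) : ℤ) - ((rowsFrom γ u - 1 : ℕ) : ℤ) = u + 1
          by omega] at h2
      omega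
  omega

theorem isCore_iff (k : ℕ) (γ : YoungDiagram) :
    IsCore (k + 1) γ ↔ ∀ t : ℤ, bead γ t = 1 → bead γ (t - (k + 1)) = 1 := by
  constructor
  · intro h t ht
    by_contra hn
    have hg : bead γ (t - (k + 1)) = 0 := by
      have := bead_eq_zero_or_one γ (t - (k + 1)); tauto
    set g := t - (k + 1) with hgdef
    set c := (g + rowsFrom γ g).toNat with hc
    have hcol : γ.colLen c = rowsFrom γ g := colLen_eq_of_bead_eq_zero hg
    have hc0 := rowsFrom_add_nonneg γ g
    set r := rowsFrom γ (t + 1) with hr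
    have hbt : rowsFrom γ t = r + 1 := by unfold bead at ht; omega
    have hrow : (γ.rowLen r : ℤ) = t + r + 1 := by
      have h1 := lt_rowsFrom_iff γ r t
      have h2 := lt_rowsFrom_iff γ r (t + 1)
      omega
    have hanti : rowsFrom γ t ≤ rowsFrom γ g := rowsFrom_antitone γ (by omega)
    have hmem : (r, c) ∈ γ := by
      rw [YoungDiagram.mem_iff_lt_colLen]; omega
    have := hookLen_eq hmem
    apply h (r, c) hmem
    change hookLen γ r c = k + 1
    omega
  · rintro h ⟨r, c⟩ hmem hhook
    have h1 := hookLen_eq hmem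
    have h2 := rowsFrom_rowLen γ r
    have h3 := rowsFrom_colLen γ c
    change hookLen γ r c = k + 1 at hhook
    have h4 := h (γ.rowLen r - r - 1) (by unfold bead; rw [sub_add_cancel]; omega)
    rw [show (γ.rowLen r : ℤ) - r - 1 - (k + 1) = c - γ.colLen c by omega] at h4
    unfold bead at h4
    omega

theorem IsCore.bead_eq_one {k : ℕ} {γ : YoungDiagram} (h : IsCore (k + 1) γ) {s t : ℤ}
    (ht : bead γ t = 1) (hd : ((k : ℤ) + 1) ∣ t - s) (hst : s ≤ t) : bead γ s = 1 := by
  rw [isCore_iff] at h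
  obtain ⟨m, hm⟩ := hd
  have hm0 : 0 ≤ m := by
    by_contra! hneg
    nlinarith
  lift m to ℕ using hm0
  induction m generalizing s with
  | zero => obtain rfl : s = t := by push_cast at hm; linarith
            exact ht
  | succ m ih =>
    have := h _ (ih (s := s + (k + 1)) (by push_cast at hm; nlinarith) (by push_cast at hm; linarith))
    rwa [add_sub_cancel_right] at this

theorem IsCore.bead_eq_zero {k : ℕ} {γ : YoungDiagram} (h : IsCore (k + 1) γ) {s t : ℤ}
    (hs : bead γ s = 0) (hd : ((k : ℤ) + 1) ∣ t - s) (hst : s ≤ t) : bead γ t = 0 := by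
  rcases bead_eq_zero_or_one γ t with h0 | h1
  · exact h0
  · have := h.bead_eq_one h1 hd hst
    omega

theorem card_column_eq (k : ℕ) (γ : YoungDiagram) (u : ℤ) :
    (((γ.cells.filter fun c => hookLen γ c.1 c.2 ≤ k).filter
      fun c => (c.2 : ℤ) - γ.colLen c.2 = u).card : ℤ) =
      (1 - bead γ u) * (rowsFrom γ u - rowsFrom γ (u + (k + 1))) := by
  have hrow : ∀ r c : ℕ, (r, c) ∈ γ →
      (hookLen γ r c ≤ k ↔ rowsFrom γ (c - γ.colLen c + (k + 1)) ≤ r) := by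
    intro r c h
    have h1 := hookLen_eq h
    have h2 := lt_rowsFrom_iff γ r (c - γ.colLen c + (k + 1))
    omega
  rcases bead_eq_zero_or_one γ u with h | h
  · have hcol := colLen_eq_of_bead_eq_zero h
    have h0 := rowsFrom_add_nonneg γ u
    have hanti : rowsFrom γ (u + (k + 1)) ≤ rowsFrom γ u := rowsFrom_antitone γ (by omega)
    have : ((γ.cells.filter fun c => hookLen γ c.1 c.2 ≤ k).filter
        fun c => (c.2 : ℤ) - γ.colLen c.2 = u) =
        (Finset.Ico (rowsFrom γ (u + (k + 1))) (rowsFrom γ u)).image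
          fun r => (r, (u + rowsFrom γ u).toNat) := by
      ext ⟨r, c⟩
      simp only [Finset.mem_filter, YoungDiagram.mem_cells, Finset.mem_image, Finset.mem_Ico,
        Prod.mk.injEq]
      constructor
      · rintro ⟨⟨hm, hh⟩, hu⟩
        rw [hrow r c hm, hu] at hh
        have h3 := (rowsFrom_colLen γ c).1
        rw [hu] at h3
        have h4 := YoungDiagram.mem_iff_lt_colLen.1 hm
        exact ⟨r, ⟨hh, by omega⟩, rfl, by omega⟩
      · rintro ⟨r', ⟨hr1, hr2⟩, rfl, rfl⟩
        have hm : (r', (u + rowsFrom γ u).toNat) ∈ γ := by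
          rw [YoungDiagram.mem_iff_lt_colLen]; omega
        have e : ((u + rowsFrom γ u).toNat : ℤ) - γ.colLen (u + rowsFrom γ u).toNat = u := by
          omega
        refine ⟨⟨hm, ?_⟩, e⟩
        rw [hrow _ _ hm, e]
        exact hr1
    rw [this, Finset.card_image_of_injective _ (fun a b hab => (Prod.mk.inj hab).1), Nat.card_Ico, h]
    omega
  · rw [h, sub_self, zero_mul, Nat.cast_eq_zero, Finset.card_eq_zero, Finset.filter_eq_empty_iff]
    rintro ⟨r, c⟩ - hu
    have h3 := rowsFrom_colLen γ c
    change (c : ℤ) - γ.colLen c = u at hu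
    rw [hu] at h3
    unfold bead at h
    omega

theorem pSize_eq_sum (k : ℕ) (γ : YoungDiagram) (A : ℤ) (h1 : γ.colLen 0 ≤ A)
    (h2 : γ.rowLen 0 ≤ A) :
    (pSize k γ : ℤ) = ∑ u ∈ Finset.Ico (-A) A,
      (1 - bead γ u) * (rowsFrom γ u - rowsFrom γ (u + (k + 1))) := by
  unfold pSize
  rw [Finset.card_eq_sum_card_fiberwise (t := Finset.Ico (-A) A)
    (f := fun c => (c.2 : ℤ) - γ.colLen c.2)]
  · push_cast
    exact Finset.sum_congr rfl fun u _ => card_column_eq k γ u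
  · rintro ⟨r, c⟩ hc
    simp only [Finset.coe_filter, Set.mem_ofPred_eq, YoungDiagram.mem_cells] at hc
    have h3 := YoungDiagram.mem_iff_lt_rowLen.1 hc.1
    have h4 := γ.rowLen_anti 0 r (Nat.zero_le _)
    have h5 := γ.colLen_anti 0 c (Nat.zero_le _)
    simp only [Finset.coe_Ico, Set.mem_Ico]
    omega

/-! ## Horizontal strips -/

/-- The number of cells of content `t` in `γ/β`, when `β ⊆ γ`. -/
noncomputable def stripCount (β γ : YoungDiagram) (t : ℤ) : ℤ :=
  rowsFrom γ t - rowsFrom β t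

theorem bead_sub_bead (β γ : YoungDiagram) (t : ℤ) :
    bead γ t - bead β t = stripCount β γ t - stripCount β γ (t + 1) := by
  unfold bead stripCount
  ring

theorem bead_sub_bead' (β γ : YoungDiagram) (t : ℤ) :
    bead γ (t - 1) - bead β (t - 1) = stripCount β γ (t - 1) - stripCount β γ t := by
  have := bead_sub_bead β γ (t - 1)
  rwa [sub_add_cancel] at this

theorem mem_of_lt_rowsFrom {γ : YoungDiagram} {r c : ℕ} {t : ℤ} (h : r < rowsFrom γ t)
    (ht : (c : ℤ) - r = t) : (r, c) ∈ γ := by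
  subst ht
  exact (mem_iff_lt_rowsFrom γ r c).2 h

theorem notMem_of_rowsFrom_le {γ : YoungDiagram} {r c : ℕ} {t : ℤ} (h : rowsFrom γ t ≤ r)
    (ht : (c : ℤ) - r = t) : (r, c) ∉ γ := by
  subst ht
  rw [mem_iff_lt_rowsFrom]
  omega

theorem rowsFrom_mono {β γ : YoungDiagram} (h : β ≤ γ) (t : ℤ) :
    rowsFrom β t ≤ rowsFrom γ t := by
  by_contra! hlt
  have h0 := rowsFrom_add_nonneg γ t
  have hm : (rowsFrom γ t, (rowsFrom γ t + t).toNat) ∈ β := mem_of_lt_rowsFrom hlt (by omega)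
  exact notMem_of_rowsFrom_le le_rfl (by omega) (h hm)

theorem IsHorizontalStrip.stripCount_eq {β γ : YoungDiagram} (h : IsHorizontalStrip β γ) (t : ℤ) :
    stripCount β γ t = 0 ∨ stripCount β γ t = 1 := by
  have h0 := rowsFrom_mono h.1 t
  have h1 := rowsFrom_add_nonneg β t
  by_contra! hne
  unfold stripCount at hne
  have hlt : rowsFrom β t + 2 ≤ rowsFrom γ t := by omega
  have ha : (rowsFrom β t + 1, (rowsFrom β t + 1 + t).toNat) ∈ γ :=
    mem_of_lt_rowsFrom (t := t) (by omega) (by omega)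
  have ha' : (rowsFrom β t + 1, (rowsFrom β t + 1 + t).toNat) ∉ β :=
    notMem_of_rowsFrom_le (t := t) (by omega) (by omega)
  have hb : (rowsFrom β t, (rowsFrom β t + 1 + t).toNat) ∉ β :=
    notMem_of_rowsFrom_le (rowsFrom_step β t).1 (by omega)
  have := h.2 _ _ ha ha' (γ.up_left_mem (by omega) le_rfl ha) hb rfl
  simp at this

theorem IsHorizontalStrip.bead_inner {β γ : YoungDiagram} (h : IsHorizontalStrip β γ) {t : ℤ}
    (ht : stripCount β γ t = 1) : bead β t = 0 := by
  rcases bead_eq_zero_or_one β t with h0 | h0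
  · exact h0
  exfalso
  have h1 := rowsFrom_add_nonneg β t
  have h2 := rowsFrom_add_nonneg β (t + 1)
  unfold stripCount at ht
  unfold bead at h0
  have ha : (rowsFrom β t, (rowsFrom β t + t).toNat) ∈ γ :=
    mem_of_lt_rowsFrom (t := t) (by omega) (by omega)
  have ha' : (rowsFrom β t, (rowsFrom β t + t).toNat) ∉ β :=
    notMem_of_rowsFrom_le (t := t) (by omega) (by omega)
  have hb : (rowsFrom β (t + 1), (rowsFrom β t + t).toNat) ∉ β :=
    notMem_of_rowsFrom_le (t := t + 1) (by omega) (by omega)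
  have := h.2 _ _ ha ha' (γ.up_left_mem (by omega) le_rfl ha) hb rfl
  simp at this
  omega

theorem IsHorizontalStrip.bead_outer {β γ : YoungDiagram} (h : IsHorizontalStrip β γ) {t : ℤ}
    (ht : stripCount β γ t = 1) : bead γ (t - 1) = 0 := by
  rcases bead_eq_zero_or_one γ (t - 1) with h0 | h0
  · exact h0
  exfalso
  have h1 := rowsFrom_add_nonneg β t
  unfold stripCount at ht
  unfold bead at h0
  rw [sub_add_cancel] at h0
  have ha : (rowsFrom γ t, (rowsFrom β t + t).toNat) ∈ γ :=
    mem_of_lt_rowsFrom (t := t - 1) (by omega) (by omega)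
  have hb' : (rowsFrom β t, (rowsFrom β t + t).toNat) ∉ β :=
    notMem_of_rowsFrom_le (t := t) (by omega) (by omega)
  have ha' : (rowsFrom γ t, (rowsFrom β t + t).toNat) ∉ β :=
    fun hm => hb' (β.up_left_mem (by omega) le_rfl hm)
  have hb : (rowsFrom β t, (rowsFrom β t + t).toNat) ∈ γ :=
    γ.up_left_mem (by omega) le_rfl ha
  have := h.2 _ _ ha ha' hb hb' rfl
  simp at this
  omega

theorem IsHorizontalStrip.stripCount_eq_one_iff {β γ : YoungDiagram} (h : IsHorizontalStrip β γ)
    (t : ℤ) : stripCount β γ t = 1 ↔ ∃ d : ℕ × ℕ, d ∈ γ ∧ d ∉ β ∧ (d.2 : ℤ) - d.1 = t := by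
  have h1 := rowsFrom_add_nonneg β t
  constructor
  · intro ht
    unfold stripCount at ht
    exact ⟨(rowsFrom β t, (rowsFrom β t + t).toNat), mem_of_lt_rowsFrom (t := t) (by omega)
      (by omega), notMem_of_rowsFrom_le (t := t) (by omega) (by omega), by dsimp only; omega⟩
  · rintro ⟨⟨r, c⟩, hd, hd', ht⟩
    dsimp only at ht
    rw [mem_iff_lt_rowsFrom, ht] at hd hd'
    have := h.stripCount_eq t
    unfold stripCount at *
    omega

theorem residue_eq_intCast (k : ℕ) (c : ℕ × ℕ) :
    residue k c = (((c.2 : ℤ) - c.1 : ℤ) : ZMod (k + 1)) := by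
  unfold residue
  push_cast
  rfl

theorem intCast_eq_iff (k : ℕ) (s t : ℤ) :
    (s : ZMod (k + 1)) = (t : ZMod (k + 1)) ↔ ((k : ℤ) + 1) ∣ t - s := by
  have := ZMod.intCast_eq_intCast_iff_dvd_sub s t (k + 1)
  push_cast at this
  exact this

theorem IsHorizontalStrip.mem_resSet_iff {β γ : YoungDiagram} (h : IsHorizontalStrip β γ)
    (k : ℕ) (i : ZMod (k + 1)) :
    i ∈ resSet k β γ ↔ ∃ t : ℤ, stripCount β γ t = 1 ∧ (t : ZMod (k + 1)) = i := by
  simp only [resSet, Finset.mem_image, Finset.mem_sdiff, YoungDiagram.mem_cells]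
  constructor
  · rintro ⟨d, ⟨h1, h2⟩, rfl⟩
    exact ⟨_, (h.stripCount_eq_one_iff _).2 ⟨d, h1, h2, rfl⟩, (residue_eq_intCast k d).symm⟩
  · rintro ⟨t, ht, rfl⟩
    obtain ⟨d, h1, h2, rfl⟩ := (h.stripCount_eq_one_iff _).1 ht
    exact ⟨d, ⟨h1, h2⟩, residue_eq_intCast k d⟩

theorem sum_Ico_telescope (f : ℤ → ℤ) {a b : ℤ} (hab : a ≤ b) :
    ∑ u ∈ Finset.Ico a b, (f (u + 1) - f u) = f b - f a := by
  induction b, hab using Int.leInduction with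
  | base => simp
  | succ b hb ih =>
    rw [← Finset.insert_Ico_right_eq_Ico_add_one hb, Finset.sum_insert (by simp), ih]
    ring

/-- The change of the number of `k`-bounded hooks along a horizontal strip. -/
theorem IsHorizontalStrip.pSize_eq {β γ : YoungDiagram} (h : IsHorizontalStrip β γ) (k : ℕ) :
    ∃ C : Finset ℤ, (∀ u, u ∈ C ↔ stripCount β γ u = 1) ∧
      (pSize k γ : ℤ) = pSize k β + ((C.filter fun u => bead β (u - (k + 1)) = 1).card : ℤ) -
        ((C.filter fun u => bead γ (u + k) = 1).card : ℤ) := by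
  set B : ℤ := γ.colLen 0 + γ.rowLen 0 + β.colLen 0 + β.rowLen 0 with hB
  set A : ℤ := B + (k + 1) with hA
  have hout : ∀ u, u ≤ -B ∨ B ≤ u → stripCount β γ u = 0 := by
    rintro u (hu | hu) <;> unfold stripCount
    · rw [rowsFrom_eq_neg γ u (by omega), rowsFrom_eq_neg β u (by omega), sub_self]
    · rw [rowsFrom_eq_zero γ u (by omega), rowsFrom_eq_zero β u (by omega), sub_self]
  set V : ℤ → ℤ := fun u => stripCount β γ u * (1 - bead β (u - (k + 1))) with hV
  set T : ℤ → ℤ := fun u => stripCount β γ u *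
    ((rowsFrom γ (u - 1) : ℤ) - rowsFrom γ (u - 1 + (k + 1))) with hT
  set W : ℤ → ℤ := fun u => -∑ s ∈ Finset.range (k + 1), V (u + s) with hW
  have hWstep : ∀ u, W (u + 1) - W u = V u - V (u + (k + 1)) := by
    intro u
    have h1 : ∑ s ∈ Finset.range (k + 1), V (u + 1 + s) + V u =
        ∑ s ∈ Finset.range (k + 1), V (u + s) + V (u + (k + 1)) := by
      have e1 := Finset.sum_range_succ (fun s : ℕ => V (u + s)) (k + 1)
      have e2 := Finset.sum_range_succ' (fun s : ℕ => V (u + s)) (k + 1)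
      rw [e1] at e2
      push_cast at e2
      rw [e2, add_zero]
      congr 1
      exact Finset.sum_congr rfl fun s _ => by rw [add_assoc, add_comm (1 : ℤ)]
    simp only [hW]
    linarith
  have hterm : ∀ u, (1 - bead γ u) * ((rowsFrom γ u : ℤ) - rowsFrom γ (u + (k + 1))) =
      (1 - bead β u) * ((rowsFrom β u : ℤ) - rowsFrom β (u + (k + 1))) +
      (stripCount β γ u * bead β (u - (k + 1)) - stripCount β γ u * bead γ (u + k)) +
      ((T (u + 1) + W (u + 1)) - (T u + W u)) := by
    intro u
    have hw := hWstep u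
    have e1 : bead γ u = bead β u + stripCount β γ u - stripCount β γ (u + 1) := by
      linarith [bead_sub_bead β γ u]
    have e2 : (rowsFrom γ u : ℤ) = rowsFrom β u + stripCount β γ u := by
      unfold stripCount; ring
    have e3 : (rowsFrom γ (u + (k + 1)) : ℤ) =
        rowsFrom β (u + (k + 1)) + stripCount β γ (u + (k + 1)) := by
      unfold stripCount; ring
    have e4 : stripCount β γ u * bead β u = 0 := by
      rcases h.stripCount_eq u with h0 | h0
      · rw [h0, zero_mul]
      · rw [h.bead_inner h0, mul_zero]
    have e5 : stripCount β γ u * ((rowsFrom γ (u - 1) : ℤ) - rowsFrom γ u) = 0 := by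
      rcases h.stripCount_eq u with h0 | h0
      · rw [h0, zero_mul]
      · have := h.bead_outer h0
        unfold bead at this
        rw [sub_add_cancel] at this
        rw [this, mul_zero]
    have e6 : bead γ (u + k) = rowsFrom γ (u + k) - rowsFrom γ (u + (k + 1)) := by
      unfold bead
      rw [add_assoc]
    have e7 : T (u + 1) = stripCount β γ (u + 1) *
        ((rowsFrom γ u : ℤ) - rowsFrom γ (u + (k + 1))) := by
      simp only [hT, add_sub_cancel_right]
    have e8 : T u = stripCount β γ u * ((rowsFrom γ (u - 1) : ℤ) - rowsFrom γ (u + k)) := by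
      simp only [hT]
      rw [show u - 1 + ((k : ℤ) + 1) = u + k by ring]
    have e9 : V (u + (k + 1)) = stripCount β γ (u + (k + 1)) * (1 - bead β u) := by
      simp only [hV, add_sub_cancel_right]
    have e10 : V u = stripCount β γ u * (1 - bead β (u - (k + 1))) := rfl
    rw [e9, e10] at hw
    rw [e7, e8, e6, e1]
    rw [e2] at e5 ⊢
    rw [e3]
    linear_combination (-1 : ℤ) * hw - e4 + e5
  have hWend : ∀ u, u + k ≤ -B ∨ B ≤ u → W u = 0 := by
    intro u hu
    simp only [hW, hV, neg_eq_zero]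
    refine Finset.sum_eq_zero fun s hs => ?_
    rw [Finset.mem_range] at hs
    rw [hout (u + s) (by omega), zero_mul]
  refine ⟨(Finset.Ico (-A) A).filter fun u => stripCount β γ u = 1, fun u => ?_, ?_⟩
  · rw [Finset.mem_filter, Finset.mem_Ico]
    refine ⟨fun hu => hu.2, fun hu => ⟨?_, hu⟩⟩
    by_contra hn
    have := hout u (by omega)
    omega
  · have hcount : ∀ f : ℤ → ℤ, (∀ u, f u = 0 ∨ f u = 1) →
        ((((Finset.Ico (-A) A).filter fun u => stripCount β γ u = 1).filter
          fun u => f u = 1).card : ℤ) = ∑ u ∈ Finset.Ico (-A) A, stripCount β γ u * f u := by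
      intro f hf
      rw [Finset.filter_filter, Finset.card_filter]
      push_cast
      refine Finset.sum_congr rfl fun u _ => ?_
      rcases h.stripCount_eq u with h0 | h0 <;> rcases hf u with h1 | h1 <;> simp [h0, h1]
    rw [hcount (fun u => bead β (u - (k + 1))) fun u => bead_eq_zero_or_one _ _,
      hcount (fun u => bead γ (u + k)) fun u => bead_eq_zero_or_one _ _,
      pSize_eq_sum k γ A (by omega) (by omega), pSize_eq_sum k β A (by omega) (by omega),
      Finset.sum_congr rfl fun u _ => hterm u, Finset.sum_add_distrib, Finset.sum_add_distrib,
      Finset.sum_sub_distrib, sum_Ico_telescope (fun u => T u + W u) (by omega)]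
    simp only [hT]
    rw [hWend A (by omega), hWend (-A) (by omega), hout A (by omega), hout (-A) (by omega)]
    ring

theorem IsHorizontalStrip.start_unique {k : ℕ} {β γ : YoungDiagram} (h : IsHorizontalStrip β γ)
    (hβ : IsCore (k + 1) β) {s t : ℤ} (hs : stripCount β γ s = 1) (ht : stripCount β γ t = 1)
    (hd : ((k : ℤ) + 1) ∣ t - s) (hbs : bead β (s - (k + 1)) = 1)
    (hbt : bead β (t - (k + 1)) = 1) : s = t := by
  have key : ∀ {s t : ℤ}, stripCount β γ s = 1 → ((k : ℤ) + 1) ∣ t - s →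
      bead β (t - (k + 1)) = 1 → t ≤ s := by
    intro s t hs hd hbt
    by_contra! hlt
    have hle : (k : ℤ) + 1 ≤ t - s := Int.le_of_dvd (by omega) hd
    have h1 : bead β s = 1 := hβ.bead_eq_one hbt
      (by rw [show t - (k + 1) - s = (t - s) - (k + 1) by ring]; exact dvd_sub_self_right.2 hd)
      (by omega)
    have := h.bead_inner hs
    omega
  exact le_antisymm (key ht ((dvd_sub_comm).1 hd) hbs) (key hs hd hbt)

theorem IsAffineStrip.exists_start {k r : ℕ} {β γ : YoungDiagram} (h : IsAffineStrip k r β γ) :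
    (∀ u, stripCount β γ u = 1 → bead γ (u + k) = 0) ∧
      ∀ u, stripCount β γ u = 1 → ∃ w, stripCount β γ w = 1 ∧ ((k : ℤ) + 1) ∣ w - u ∧
        bead β (w - (k + 1)) = 1 := by
  obtain ⟨-, hβ, -, hs, hsize, hcard⟩ := h
  obtain ⟨C, hC, hp⟩ := hs.pSize_eq k
  set S := C.filter fun u => bead β (u - (k + 1)) = 1 with hS
  have hinj : Set.InjOn (fun u : ℤ => (u : ZMod (k + 1))) S := by
    intro s hs1 t ht1 hst
    rw [Finset.mem_coe, hS, Finset.mem_filter, hC] at hs1 ht1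
    exact hs.start_unique hβ hs1.1 ht1.1 ((intCast_eq_iff k s t).1 hst) hs1.2 ht1.2
  have hsub : S.image (fun u : ℤ => (u : ZMod (k + 1))) ⊆ resSet k β γ := by
    intro j hj
    obtain ⟨u, hu, rfl⟩ := Finset.mem_image.1 hj
    exact (hs.mem_resSet_iff k _).2 ⟨u, (hC u).1 (Finset.mem_filter.1 hu).1, rfl⟩
  have hle := Finset.card_le_card hsub
  rw [Finset.card_image_of_injOn hinj] at hle
  have heq := Finset.eq_of_subset_of_card_le hsub
    (by rw [Finset.card_image_of_injOn hinj]; omega)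
  have hempty : (C.filter fun u => bead γ (u + k) = 1) = ∅ := by
    rw [← Finset.card_eq_zero]; omega
  constructor
  · intro u hu
    have := Finset.filter_eq_empty_iff.1 hempty ((hC u).2 hu)
    have := bead_eq_zero_or_one γ (u + k)
    tauto
  · intro u hu
    have : (u : ZMod (k + 1)) ∈ resSet k β γ := (hs.mem_resSet_iff k _).2 ⟨u, hu, rfl⟩
    rw [← heq, Finset.mem_image] at this
    obtain ⟨w, hw, hwu⟩ := this
    rw [hS, Finset.mem_filter, hC] at hw
    exact ⟨w, hw.1, dvd_sub_comm.1 ((intCast_eq_iff k w u).1 hwu), hw.2⟩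

theorem IsAffineStrip.not_forall_mem_resSet {k r : ℕ} {β γ : YoungDiagram}
    (h : IsAffineStrip k r β γ) : ∃ j, j ∉ resSet k β γ := by
  by_contra! hall
  have h1 : (resSet k β γ).card = k + 1 := by
    rw [Finset.eq_univ_of_forall hall, Finset.card_univ, ZMod.card]
  have h2 := h.1
  have h3 := h.2.2.2.2.2
  omega

theorem IsAffineStrip.stripCount_add {k r : ℕ} {β γ : YoungDiagram} (h : IsAffineStrip k r β γ)
    {u x : ℤ} (hu : stripCount β γ u = 1) (hx : stripCount β γ x = 1)
    (hd : ((k : ℤ) + 1) ∣ x - u) (hlt : u < x) : stripCount β γ (u + (k + 1)) = 1 := by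
  obtain ⟨hbad, hstart⟩ := h.exists_start
  have hβ := h.2.1
  have hs := h.2.2.2.1
  by_contra hne
  have hne0 : stripCount β γ (u + (k + 1)) = 0 := by
    have := hs.stripCount_eq (u + (k + 1)); tauto
  have hle : (k : ℤ) + 1 ≤ x - u := Int.le_of_dvd (by omega) hd
  have hne' : x ≠ u + (k + 1) := by rintro rfl; omega
  have step : ∀ m : ℕ, stripCount β γ (u - m) = 1 ∧ stripCount β γ (u - m + (k + 1)) = 0 ∧
      stripCount β γ (x - m) = 1 := by
    intro m
    induction m with
    | zero => simpa using ⟨hu, hne0, hx⟩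
    | succ m ih =>
      obtain ⟨i1, i2, i3⟩ := ih
      push_cast
      rw [← sub_sub, ← sub_sub]
      have a1 := hbad _ i1
      have a2 := bead_sub_bead β γ (u - m + k)
      rw [add_assoc (u - m : ℤ) (k : ℤ) 1, i2, a1] at a2
      have a3 := hs.stripCount_eq (u - m + k)
      have a4 := bead_eq_zero_or_one β (u - m + k)
      have a5 : stripCount β γ (u - m + k) = 0 := by omega
      have a6 : bead β (u - m + k) = 0 := by omega
      have a7 : bead β (x - m - 1) = 0 := hβ.bead_eq_zero a6
        (by rw [show x - m - 1 - (u - m + k) = x - u - (k + 1) by ring]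
            exact dvd_sub_self_right.2 hd) (by omega)
      have a8 := bead_sub_bead' β γ (x - m)
      have a9 := bead_eq_zero_or_one γ (x - m - 1)
      have a10 := hs.stripCount_eq (x - m - 1)
      have a11 : stripCount β γ (x - m - 1) = 1 := by omega
      obtain ⟨w, w1, w2, w3⟩ := hstart _ a11
      have w4 := hs.bead_inner w1
      have w5 : ((k : ℤ) + 1) ∣ (u - m + k) - w := by
        rw [show (u - m + k) - w = -(w - (x - m - 1)) - (x - u - (k + 1)) by ring]
        exact dvd_sub (dvd_neg.2 w2) (dvd_sub_self_right.2 hd)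
      have w6 : w ≤ u - m + k := by
        by_contra! hlt'
        have hle' : (k : ℤ) + 1 ≤ w - (u - m + k) :=
          Int.le_of_dvd (by omega) (dvd_sub_comm.1 w5)
        have := hβ.bead_eq_one (s := u - m + k) w3
          (by rw [show w - (k + 1) - (u - m + k) = (w - (u - m + k)) - (k + 1) by ring]
              exact dvd_sub_self_right.2 (dvd_sub_comm.1 w5)) (by omega)
        omega
      have w7 : w ≠ u - m + k := by rintro rfl; omega
      have w8 : (k : ℤ) + 1 ≤ (u - m + k) - w := Int.le_of_dvd (by omega) w5
      have a12 : bead β (u - m - 1) = 0 := hβ.bead_eq_zero w4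
        (by rw [show u - m - 1 - w = (u - m + k) - w - (k + 1) by ring]
            exact dvd_sub_self_right.2 w5) (by omega)
      have a13 := bead_sub_bead' β γ (u - m)
      have a14 := bead_eq_zero_or_one γ (u - m - 1)
      have a15 := hs.stripCount_eq (u - m - 1)
      refine ⟨by omega, ?_, a11⟩
      rw [show u - m - 1 + ((k : ℤ) + 1) = u - m + k by ring]
      exact a5
  obtain ⟨j, hj⟩ := h.not_forall_mem_resSet
  refine hj ((hs.mem_resSet_iff k j).2 ⟨u - (((u : ZMod (k + 1)) - j).val : ℕ), (step _).1, ?_⟩)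
  push_cast
  rw [ZMod.natCast_zmod_val]
  ring

theorem IsAffineStrip.stripCount_between {k r : ℕ} {β γ : YoungDiagram}
    (h : IsAffineStrip k r β γ) {u w x : ℤ} (hu : stripCount β γ u = 1)
    (hx : stripCount β γ x = 1) (hd : ((k : ℤ) + 1) ∣ x - u) (hdw : ((k : ℤ) + 1) ∣ w - u)
    (huw : u ≤ w) (hwx : w ≤ x) : stripCount β γ w = 1 := by
  obtain ⟨m, hm⟩ := hdw
  have hm0 : 0 ≤ m := by
    by_contra! hneg
    nlinarith
  lift m to ℕ using hm0
  induction m generalizing w with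
  | zero => obtain rfl : w = u := by push_cast at hm; linarith
            exact hu
  | succ m ih =>
    push_cast at hm
    have e : w - (k + 1) - u = (k + 1) * m := by linarith
    have h1 := ih (w := w - (k + 1)) (by nlinarith) (by linarith) e
    have h2 := h.stripCount_add h1 hx (by
      rw [show x - (w - (k + 1)) = (x - u) - (w - (k + 1) - u) by ring, e]
      exact dvd_sub hd (dvd_mul_right _ _)) (by linarith)
    rwa [sub_add_cancel] at h2

/-! ## Corners -/

theorem removable_iff (γ : YoungDiagram) (d : ℕ × ℕ) :
    Removable γ d ↔ rowsFrom γ ((d.2 : ℤ) - d.1) = d.1 + 1 ∧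
      bead γ ((d.2 : ℤ) - d.1) = 1 ∧ bead γ ((d.2 : ℤ) - d.1 - 1) = 0 := by
  obtain ⟨r, c⟩ := d
  have h1 := rowsFrom_step γ ((c : ℤ) - r)
  have h2 := rowsFrom_step γ ((c : ℤ) - r - 1)
  rw [sub_add_cancel] at h2
  have e1 : (c : ℤ) - ((r + 1 : ℕ) : ℤ) = c - r - 1 := by push_cast; ring
  have e2 : ((c + 1 : ℕ) : ℤ) - r = c - r + 1 := by push_cast; ring
  unfold Removable bead
  simp only [mem_iff_lt_rowsFrom, e1, e2, sub_add_cancel]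
  omega

theorem addable_iff (γ : YoungDiagram) (d : ℕ × ℕ) :
    Addable γ d ↔ rowsFrom γ ((d.2 : ℤ) - d.1) = d.1 ∧
      bead γ ((d.2 : ℤ) - d.1) = 0 ∧ bead γ ((d.2 : ℤ) - d.1 - 1) = 1 := by
  obtain ⟨r, c⟩ := d
  have h1 := rowsFrom_step γ ((c : ℤ) - r)
  have h2 := rowsFrom_step γ ((c : ℤ) - r - 1)
  have h3 := rowsFrom_add_nonneg γ ((c : ℤ) - r)
  have h4 := rowsFrom_add_nonneg γ ((c : ℤ) - r - 1)
  rw [sub_add_cancel] at h2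
  have hleft : 0 < c → ((r, c - 1) ∈ γ ↔ r < rowsFrom γ ((c : ℤ) - r - 1)) := by
    intro hc
    rw [mem_iff_lt_rowsFrom, show ((c - 1 : ℕ) : ℤ) - r = c - r - 1 by omega]
  have hbelow : 0 < r → ((r - 1, c) ∈ γ ↔ r - 1 < rowsFrom γ ((c : ℤ) - r + 1)) := by
    intro hr
    rw [mem_iff_lt_rowsFrom, show (c : ℤ) - ((r - 1 : ℕ) : ℤ) = c - r + 1 by omega]
  have hself := mem_iff_lt_rowsFrom γ r c
  unfold Addable bead
  simp only [sub_add_cancel]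
  constructor
  · rintro ⟨ha, hb⟩
    have hl : 0 < c → r < rowsFrom γ ((c : ℤ) - r - 1) := fun hc =>
      (hleft hc).1 (hb _ ⟨le_rfl, Nat.sub_le _ _⟩ (by simp; omega))
    have hd : 0 < r → r - 1 < rowsFrom γ ((c : ℤ) - r + 1) := fun hr =>
      (hbelow hr).1 (hb _ ⟨Nat.sub_le _ _, le_rfl⟩ (by simp; omega))
    have hn := hself.not.1 ha
    omega
  · intro h
    refine ⟨hself.not.2 (by omega), ?_⟩
    rintro ⟨r', c'⟩ hle hne
    obtain ⟨hr', hc'⟩ : r' ≤ r ∧ c' ≤ c := hle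
    simp only [ne_eq, Prod.mk.injEq] at hne
    rcases lt_or_ge c' c with hlt | hge
    · exact γ.up_left_mem hr' (by omega) ((hleft (by omega)).2 (by omega))
    · exact γ.up_left_mem (by omega) hc' ((hbelow (by omega)).2 (by omega))

theorem mem_addableSet_iff (k : ℕ) (i : ZMod (k + 1)) (γ : YoungDiagram) (d : ℕ × ℕ) :
    d ∈ addableSet k i γ ↔ Addable γ d ∧ residue k d = i := by
  unfold addableSet
  rw [Finset.mem_filter, and_iff_right_iff_imp]
  rintro ⟨h, -⟩
  obtain ⟨r, c⟩ := d
  rw [Finset.mem_image]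
  have h1 := YoungDiagram.mem_iff_lt_rowLen.not.1 h.1
  have h2 : 0 < c → c - 1 < γ.rowLen r := fun hc =>
    YoungDiagram.mem_iff_lt_rowLen.1 (h.2 (r, c - 1) ⟨le_rfl, Nat.sub_le _ _⟩ (by simp; omega))
  have h3 : 0 < r → r - 1 < γ.colLen c := fun hr =>
    YoungDiagram.mem_iff_lt_colLen.1 (h.2 (r - 1, c) ⟨Nat.sub_le _ _, le_rfl⟩ (by simp; omega))
  have h4 := γ.colLen_anti 0 c (Nat.zero_le _)
  exact ⟨r, Finset.mem_range.2 (by omega), by rw [Prod.mk.injEq]; omega⟩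

theorem intCast_succ_ne {k : ℕ} (hk : 1 ≤ k) (t : ℤ) :
    ((t + 1 : ℤ) : ZMod (k + 1)) ≠ (t : ZMod (k + 1)) := by
  rw [ne_eq, intCast_eq_iff]
  intro h
  have := Int.le_of_dvd (by norm_num) ((dvd_sub_comm).1 h)
  omega

theorem intCast_sub_period (k : ℕ) (t : ℤ) :
    ((t - (k + 1) : ℤ) : ZMod (k + 1)) = (t : ZMod (k + 1)) := by
  rw [intCast_eq_iff, sub_sub_cancel]

section RemoveCorners

variable {k : ℕ} {i : ZMod (k + 1)} {γ γhat : YoungDiagram}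

theorem mem_of_removeCorners
    (hcells : γhat.cells = γ.cells.filter fun d => ¬ (Removable γ d ∧ residue k d = i))
    (d : ℕ × ℕ) : d ∈ γhat ↔ d ∈ γ ∧ ¬ (Removable γ d ∧ residue k d = i) := by
  rw [← YoungDiagram.mem_cells, hcells, Finset.mem_filter, YoungDiagram.mem_cells]

theorem isHorizontalStrip_removeCorners
    (hcells : γhat.cells = γ.cells.filter fun d => ¬ (Removable γ d ∧ residue k d = i)) :
    IsHorizontalStrip γhat γ := by
  have hmem := mem_of_removeCorners hcells
  refine ⟨fun d hd => ((hmem d).1 hd).1, ?_⟩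
  have key : ∀ r r' c : ℕ, (r', c) ∈ γ → Removable γ (r, c) → r' ≤ r := by
    intro r r' c h' h
    by_contra! hlt
    exact h.2.1 (γ.up_left_mem hlt le_rfl h')
  rintro ⟨r, c⟩ ⟨r', c'⟩ h1 h2 h3 h4 (rfl : c = c')
  rw [hmem] at h2 h4
  have e1 : Removable γ (r, c) := by tauto
  have e2 : Removable γ (r', c) := by tauto
  rw [le_antisymm (key _ _ _ h1 e2) (key _ _ _ h3 e1)]

theorem stripCount_removeCorners
    (hcells : γhat.cells = γ.cells.filter fun d => ¬ (Removable γ d ∧ residue k d = i)) (t : ℤ) :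
    stripCount γhat γ t = 1 ↔
      (t : ZMod (k + 1)) = i ∧ bead γ t = 1 ∧ bead γ (t - 1) = 0 := by
  have hmem := mem_of_removeCorners hcells
  rw [(isHorizontalStrip_removeCorners hcells).stripCount_eq_one_iff]
  constructor
  · rintro ⟨d, h1, h2, rfl⟩
    rw [hmem] at h2
    have h3 : Removable γ d ∧ residue k d = i := by tauto
    exact ⟨by rw [← residue_eq_intCast]; exact h3.2, ((removable_iff γ d).1 h3.1).2⟩
  · rintro ⟨h1, h2, h3⟩
    have h4 := rowsFrom_add_nonneg γ (t + 1)
    have h5 := h2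
    unfold bead at h5
    have e : (((rowsFrom γ (t + 1) + t).toNat : ℕ) : ℤ) - (rowsFrom γ (t + 1) : ℕ) = t := by
      have h6 := rowsFrom_add_nonneg γ (t - 1)
      unfold bead at h3
      rw [sub_add_cancel] at h3
      omega
    have hr : Removable γ (rowsFrom γ (t + 1), (rowsFrom γ (t + 1) + t).toNat) := by
      rw [removable_iff]
      dsimp only
      rw [e]
      exact ⟨by omega, h2, h3⟩
    refine ⟨_, hr.1, fun hn => ((hmem _).1 hn).2 ⟨hr, ?_⟩, e⟩
    rw [residue_eq_intCast]
    dsimp only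
    rw [e, h1]

theorem isCore_removeCorners (hk : 1 ≤ k) (hγ : IsCore (k + 1) γ)
    (hcells : γhat.cells = γ.cells.filter fun d => ¬ (Removable γ d ∧ residue k d = i)) :
    IsCore (k + 1) γhat := by
  have hs := isHorizontalStrip_removeCorners hcells
  have hc := stripCount_removeCorners hcells
  rw [isCore_iff] at hγ ⊢
  intro t ht
  have p1 := hγ t
  have p2 := hγ (t - 1)
  have p3 := hγ (t + 1)
  rw [show t - 1 - ((k : ℤ) + 1) = t - (k + 1) - 1 by ring] at p2
  rw [show t + 1 - ((k : ℤ) + 1) = t - (k + 1) + 1 by ring] at p3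
  have q1 := bead_sub_bead γhat γ t
  have q2 := bead_sub_bead γhat γ (t - (k + 1))
  have c1 := hc t
  have c2 := hc (t + 1)
  have c3 := hc (t - (k + 1))
  have c4 := hc (t - (k + 1) + 1)
  rw [intCast_sub_period] at c3
  rw [show t - ((k : ℤ) + 1) + 1 = t + 1 - (k + 1) by ring, intCast_sub_period,
    show t + 1 - ((k : ℤ) + 1) = t - (k + 1) + 1 by ring] at c4
  rw [add_sub_cancel_right] at c2 c4
  have hne := intCast_succ_ne hk t
  have hne' : ¬ (((t + 1 : ℤ) : ZMod (k + 1)) = i ∧ (t : ZMod (k + 1)) = i) :=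
    fun h => hne (h.1.trans h.2.symm)
  have s1 := hs.stripCount_eq t
  have s2 := hs.stripCount_eq (t + 1)
  have s3 := hs.stripCount_eq (t - (k + 1))
  have s4 := hs.stripCount_eq (t - (k + 1) + 1)
  have b1 := bead_eq_zero_or_one γ t
  have b2 := bead_eq_zero_or_one γ (t - 1)
  have b3 := bead_eq_zero_or_one γ (t + 1)
  have b4 := bead_eq_zero_or_one γ (t - (k + 1))
  have b5 := bead_eq_zero_or_one γhat (t - (k + 1))
  clear hc hne
  generalize (((t + 1 : ℤ) : ZMod (k + 1)) = i) = P at *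
  generalize ((t : ZMod (k + 1)) = i) = Q at *
  by_cases hP : P <;> by_cases hQ : Q <;>
    simp only [hP, hQ, true_and, false_and, and_self, not_true, iff_false] at c1 c2 c3 c4 hne' <;>
    omega

theorem pSize_removeCorners (hk : 1 ≤ k) (hγ : IsCore (k + 1) γ)
    (hcells : γhat.cells = γ.cells.filter fun d => ¬ (Removable γ d ∧ residue k d = i))
    (hex : ∃ d, Removable γ d ∧ residue k d = i) : pSize k γ = pSize k γhat + 1 := by
  have hs := isHorizontalStrip_removeCorners hcells
  have hc := stripCount_removeCorners hcells
  have hhat := isCore_removeCorners hk hγ hcells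
  obtain ⟨C, hC, hp⟩ := hs.pSize_eq k
  have hne : C.Nonempty := by
    obtain ⟨d, hd, hi⟩ := hex
    refine ⟨(d.2 : ℤ) - d.1, (hC _).2 ((hc _).2 ⟨?_, ((removable_iff γ d).1 hd).2⟩)⟩
    rwa [← residue_eq_intCast]
  have hbad : (C.filter fun u => bead γ (u + k) = 1) = ∅ := by
    rw [Finset.filter_eq_empty_iff]
    intro u hu
    have h1 := ((hc u).1 ((hC u).1 hu)).2.2
    have h2 := hγ.bead_eq_zero (t := u + k) h1
      (by rw [show u + k - (u - 1) = (k : ℤ) + 1 by ring]) (by omega)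
    omega
  have hone : (C.filter fun u => bead γhat (u - (k + 1)) = 1).card = 1 := by
    rw [Finset.card_eq_one]
    set m := C.min' hne with hm
    have hmC : stripCount γhat γ m = 1 := (hC m).1 (C.min'_mem hne)
    have hstart : bead γhat (m - (k + 1)) = 1 := by
      obtain ⟨h1, h2, -⟩ := (hc m).1 hmC
      have h3 := (isCore_iff k γ).1 hγ m h2
      have h4 : stripCount γhat γ (m - (k + 1)) ≠ 1 := fun h => by
        have := C.min'_le _ ((hC _).2 h)
        omega
      have h5 : stripCount γhat γ (m - (k + 1) + 1) ≠ 1 := fun h => by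
        have h6 := ((hc _).1 h).1
        rw [show m - ((k : ℤ) + 1) + 1 = m + 1 - (k + 1) by ring, intCast_sub_period] at h6
        exact intCast_succ_ne hk m (h6.trans h1.symm)
      have h7 := hs.stripCount_eq (m - (k + 1))
      have h8 := hs.stripCount_eq (m - (k + 1) + 1)
      have h9 := bead_sub_bead γhat γ (m - (k + 1))
      omega
    refine ⟨m, Finset.eq_singleton_iff_unique_mem.2
      ⟨Finset.mem_filter.2 ⟨C.min'_mem hne, hstart⟩, fun u hu => ?_⟩⟩
    rw [Finset.mem_filter, hC] at hu
    refine hs.start_unique hhat hu.1 hmC ?_ hu.2 hstart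
    rw [← intCast_eq_iff, ((hc u).1 hu.1).1, ((hc m).1 hmC).1]
  rw [hbad, hone] at hp
  push_cast at hp
  rw [Finset.card_empty] at hp
  omega

end RemoveCorners

theorem isCore_addCorners {k : ℕ} (hk : 1 ≤ k) {i : ZMod (k + 1)} {ρ ρhat : YoungDiagram}
    (hρ : IsCore (k + 1) ρ) (hcells : ρhat.cells = ρ.cells ∪ addableSet k i ρ) :
    IsCore (k + 1) ρhat := by
  have hmem : ∀ d, d ∈ ρhat ↔ d ∈ ρ ∨ Addable ρ d ∧ residue k d = i := by
    intro d
    rw [← YoungDiagram.mem_cells, hcells, Finset.mem_union, mem_addableSet_iff,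
      YoungDiagram.mem_cells]
  have hs : IsHorizontalStrip ρ ρhat := by
    refine ⟨fun d hd => (hmem d).2 (Or.inl hd), ?_⟩
    have key : ∀ r r' c : ℕ, (r', c) ∉ ρ → Addable ρ (r, c) → r ≤ r' := by
      intro r r' c h' h
      by_contra! hlt
      exact h' (h.2 _ ⟨hlt.le, le_rfl⟩ (by simp; omega))
    rintro ⟨r, c⟩ ⟨r', c'⟩ h1 h2 h3 h4 (rfl : c = c')
    rw [hmem] at h1 h3
    have e1 : Addable ρ (r, c) := by tauto
    have e2 : Addable ρ (r', c) := by tauto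
    rw [le_antisymm (key _ _ _ h4 e1) (key _ _ _ h2 e2)]
  have hc : ∀ t, stripCount ρ ρhat t = 1 ↔
      (t : ZMod (k + 1)) = i ∧ bead ρ t = 0 ∧ bead ρ (t - 1) = 1 := by
    intro t
    rw [hs.stripCount_eq_one_iff]
    constructor
    · rintro ⟨d, h1, h2, rfl⟩
      rw [hmem] at h1
      have h3 : Addable ρ d ∧ residue k d = i := by tauto
      exact ⟨by rw [← residue_eq_intCast]; exact h3.2, ((addable_iff ρ d).1 h3.1).2⟩
    · rintro ⟨h1, h2, h3⟩
      have h4 := rowsFrom_add_nonneg ρ t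
      have e : (((rowsFrom ρ t + t).toNat : ℕ) : ℤ) - (rowsFrom ρ t : ℕ) = t := by omega
      have ha : Addable ρ (rowsFrom ρ t, (rowsFrom ρ t + t).toNat) := by
        rw [addable_iff]
        dsimp only
        rw [e]
        exact ⟨rfl, h2, h3⟩
      refine ⟨_, (hmem _).2 (Or.inr ⟨ha, ?_⟩), ha.1, e⟩
      rw [residue_eq_intCast]
      dsimp only
      rw [e, h1]
  rw [isCore_iff] at hρ ⊢
  intro t ht
  have p1 := hρ t
  have p2 := hρ (t - 1)
  have p3 := hρ (t + 1)
  rw [show t - 1 - ((k : ℤ) + 1) = t - (k + 1) - 1 by ring] at p2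
  rw [show t + 1 - ((k : ℤ) + 1) = t - (k + 1) + 1 by ring] at p3
  have q1 := bead_sub_bead ρ ρhat t
  have q2 := bead_sub_bead ρ ρhat (t - (k + 1))
  have c1 := hc t
  have c2 := hc (t + 1)
  have c3 := hc (t - (k + 1))
  have c4 := hc (t - (k + 1) + 1)
  rw [intCast_sub_period] at c3
  rw [show t - ((k : ℤ) + 1) + 1 = t + 1 - (k + 1) by ring, intCast_sub_period,
    show t + 1 - ((k : ℤ) + 1) = t - (k + 1) + 1 by ring] at c4
  rw [add_sub_cancel_right] at c2 c4
  have hne := intCast_succ_ne hk t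
  have hne' : ¬ (((t + 1 : ℤ) : ZMod (k + 1)) = i ∧ (t : ZMod (k + 1)) = i) :=
    fun h => hne (h.1.trans h.2.symm)
  have s1 := hs.stripCount_eq t
  have s2 := hs.stripCount_eq (t + 1)
  have s3 := hs.stripCount_eq (t - (k + 1))
  have s4 := hs.stripCount_eq (t - (k + 1) + 1)
  have b1 := bead_eq_zero_or_one ρ t
  have b2 := bead_eq_zero_or_one ρ (t - 1)
  have b3 := bead_eq_zero_or_one ρ (t + 1)
  have b4 := bead_eq_zero_or_one ρ (t - (k + 1))
  have b5 := bead_eq_zero_or_one ρhat (t - (k + 1))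
  clear hc hne
  generalize (((t + 1 : ℤ) : ZMod (k + 1)) = i) = P at *
  generalize ((t : ZMod (k + 1)) = i) = Q at *
  by_cases hP : P <;> by_cases hQ : Q <;>
    simp only [hP, hQ, true_and, false_and, and_self, not_true, iff_false] at c1 c2 c3 c4 hne' <;>
    omega

/-! ## Peeling off the rightmost residue -/

/-- The residue following that of the rightmost cell does not occur in the strip. -/
theorem IsHorizontalStrip.residue_rightmost_succ {k : ℕ} {ρ γ : YoungDiagram}
    (h : IsHorizontalStrip ρ γ) (hγ : IsCore (k + 1) γ) {c : ℕ × ℕ} (hcγ : c ∈ γ) (hcρ : c ∉ ρ)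
    (hrightmost : ∀ d : ℕ × ℕ, d ∈ γ → d ∉ ρ → d.2 ≤ c.2) :
    residue k c + 1 ∉ resSet k ρ γ := by
  have hmax : ∀ t, stripCount ρ γ t = 1 → t ≤ (c.2 : ℤ) - c.1 := by
    intro t ht
    obtain ⟨d, h1, h2, rfl⟩ := (h.stripCount_eq_one_iff t).1 ht
    by_contra! hlt
    have h3 := hrightmost d h1 h2
    have h4 : ((d.1, c.2) : ℕ × ℕ) ∈ γ := γ.up_left_mem (by omega) le_rfl hcγ
    have h5 : ((d.1, c.2) : ℕ × ℕ) ∉ ρ := fun hm => h2 (ρ.up_left_mem le_rfl h3 hm)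
    have h6 := congrArg Prod.fst (h.2 _ _ h4 h5 hcγ hcρ rfl)
    dsimp only at h6
    omega
  rw [h.mem_resSet_iff, residue_eq_intCast]
  rintro ⟨t, ht, hres⟩
  have h1 := (h.stripCount_eq_one_iff _).2 ⟨c, hcγ, hcρ, rfl⟩
  have h2 := hmax t ht
  have h3 : stripCount ρ γ ((c.2 : ℤ) - c.1 + 1) ≠ 1 := fun h' => by
    have := hmax _ h'; omega
  have h4 := h.stripCount_eq ((c.2 : ℤ) - c.1 + 1)
  have h5 := bead_sub_bead ρ γ ((c.2 : ℤ) - c.1)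
  have h6 := h.bead_inner h1
  have h7 := h.bead_outer ht
  have h8 : bead γ (t - 1) = 1 := hγ.bead_eq_one (t := (c.2 : ℤ) - c.1) (by omega)
    (by rw [← intCast_eq_iff, Int.cast_sub t, hres]; push_cast; ring) (by omega)
  omega

/-- If `i` occurs in an affine strip and `i + 1` does not, then every removable `i`-corner of the
outer shape lies in the strip. -/
theorem IsAffineStrip.notMem_of_removable {k r : ℕ} {β γ : YoungDiagram}
    (h : IsAffineStrip k r β γ) {d : ℕ × ℕ} (hd : Removable γ d)
    (hi : residue k d ∈ resSet k β γ) (hi' : residue k d + 1 ∉ resSet k β γ) : d ∉ β := by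
  intro hdβ
  have hβ := h.2.1
  have hs := h.2.2.2.1
  obtain ⟨-, hstart⟩ := h.exists_start
  obtain ⟨hd1, hd2, hd3⟩ := (removable_iff γ d).1 hd
  have hdβ' := (mem_iff_lt_rowsFrom β d.1 d.2).1 hdβ
  rw [hs.mem_resSet_iff, residue_eq_intCast] at hi hi'
  set t : ℤ := (d.2 : ℤ) - d.1 with ht
  have a1 : stripCount β γ t = 0 := by
    have := rowsFrom_mono hs.1 t
    unfold stripCount
    omega
  have a2 : stripCount β γ (t + 1) = 0 := by
    rcases hs.stripCount_eq (t + 1) with h0 | h0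
    · exact h0
    · exact absurd ⟨t + 1, h0, by push_cast; ring⟩ hi'
  have a3 := bead_sub_bead β γ t
  have a4 := bead_sub_bead' β γ t
  have a5 := bead_eq_zero_or_one β (t - 1)
  have a6 := hs.stripCount_eq (t - 1)
  obtain ⟨u, hu, hut⟩ := hi
  obtain ⟨w, w1, w2, w3⟩ := hstart u hu
  have w4 : ((k : ℤ) + 1) ∣ w - t := by
    have := (intCast_eq_iff k t u).1 hut.symm
    rw [show w - t = (w - u) + (u - t) by ring]
    exact dvd_add w2 this
  have w5 := hs.bead_inner w1
  have w6 : t < w := by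
    by_contra! hle
    have := hβ.bead_eq_one (s := w) (t := t) (by omega) (dvd_sub_comm.1 w4) hle
    omega
  have a7 : bead β (w - 1) = 0 := hβ.bead_eq_zero (s := t - 1) (by omega)
    (by rw [sub_sub_sub_cancel_right]; exact w4) (by omega)
  have a8 := bead_sub_bead' β γ w
  have a9 := bead_eq_zero_or_one γ (w - 1)
  have a10 := hs.stripCount_eq (w - 1)
  have a11 : stripCount β γ (w - 1) = 1 := by omega
  obtain ⟨v, v1, v2, v3⟩ := hstart _ a11
  have v4 : ((k : ℤ) + 1) ∣ t - 1 - v := by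
    rw [show t - 1 - v = -(w - t) - (v - (w - 1)) by ring]
    exact dvd_sub (dvd_neg.2 w4) v2
  have v5 : v ≤ t - 1 := by
    by_contra! hlt
    have hle : (k : ℤ) + 1 ≤ v - (t - 1) := Int.le_of_dvd (by omega) (dvd_sub_comm.1 v4)
    have := hβ.bead_eq_one (s := t - 1) v3
      (by rw [show v - (k + 1) - (t - 1) = v - (t - 1) - (k + 1) by ring]
          exact dvd_sub_self_right.2 (dvd_sub_comm.1 v4)) (by omega)
    omega
  have := h.stripCount_between v1 a11 (dvd_sub_comm.1 v2) v4 v5 (by omega)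
  omega

theorem residue_right (k r c : ℕ) : residue k (r, c + 1) = residue k (r, c) + 1 := by
  unfold residue
  push_cast
  ring

/-- A cell of a horizontal strip is a removable corner if the next residue does not occur. -/
theorem IsHorizontalStrip.removable {k : ℕ} {β γ : YoungDiagram} (h : IsHorizontalStrip β γ)
    {d : ℕ × ℕ} (hd : d ∈ γ) (hd' : d ∉ β) (hi' : residue k d + 1 ∉ resSet k β γ) :
    Removable γ d := by
  obtain ⟨r, c⟩ := d
  refine ⟨hd, fun hm => ?_, fun hm => hi' ?_⟩
  · have h1 : (r + 1, c) ∉ β := fun h2 => hd' (β.up_left_mem (Nat.le_succ r) le_rfl h2)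
    have := congrArg Prod.fst (h.2 _ _ hm h1 hd hd' rfl)
    simp at this
  · have h1 : (r, c + 1) ∉ β := fun h2 => hd' (β.up_left_mem le_rfl (Nat.le_succ c) h2)
    rw [← residue_right]
    exact Finset.mem_image_of_mem _
      (Finset.mem_sdiff.2 ⟨(YoungDiagram.mem_cells _).2 hm, by rwa [YoungDiagram.mem_cells]⟩)

theorem mem_resSet_of_mem {k : ℕ} {β γ : YoungDiagram} {d : ℕ × ℕ} (h : d ∈ γ) (h' : d ∉ β) :
    residue k d ∈ resSet k β γ :=
  Finset.mem_image_of_mem _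
    (Finset.mem_sdiff.2 ⟨(YoungDiagram.mem_cells _).2 h, by rwa [YoungDiagram.mem_cells]⟩)

theorem exists_of_mem_resSet {k : ℕ} {β γ : YoungDiagram} {i : ZMod (k + 1)}
    (h : i ∈ resSet k β γ) : ∃ d, d ∈ γ ∧ d ∉ β ∧ residue k d = i := by
  obtain ⟨d, hd, rfl⟩ := Finset.mem_image.1 h
  rw [Finset.mem_sdiff, YoungDiagram.mem_cells, YoungDiagram.mem_cells] at hd
  exact ⟨d, hd.1, hd.2, rfl⟩

theorem resSet_mono_left {k : ℕ} {ρ β γ : YoungDiagram} (h : ρ ≤ β) :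
    resSet k β γ ⊆ resSet k ρ γ := by
  intro i hi
  obtain ⟨d, h1, h2, rfl⟩ := exists_of_mem_resSet hi
  exact mem_resSet_of_mem h1 fun hm => h2 (h hm)

theorem resSet_mono_right {k : ℕ} {ρ β γ : YoungDiagram} (h : β ≤ γ) :
    resSet k ρ β ⊆ resSet k ρ γ := by
  intro i hi
  obtain ⟨d, h1, h2, rfl⟩ := exists_of_mem_resSet hi
  exact mem_resSet_of_mem (h h1) h2

theorem IsHorizontalStrip.mono {ρ ρ' γ γ' : YoungDiagram} (h : IsHorizontalStrip ρ γ)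
    (hρ : ρ ≤ ρ') (hγ : γ' ≤ γ) (h' : ρ' ≤ γ') : IsHorizontalStrip ρ' γ' :=
  ⟨h', fun c d h1 h2 h3 h4 => h.2 c d (hγ h1) (fun h => h2 (hρ h)) (hγ h3) fun h => h4 (hρ h)⟩

theorem IsAffineSVStrip.removeCorners {k : ℕ} (hk : 1 ≤ k) {r : ℕ} {ρ β γ γhat : YoungDiagram}
    (h : IsAffineSVStrip k r ρ β γ) {i : ZMod (k + 1)} (hi : i ∈ resSet k β γ)
    (hi' : i + 1 ∉ resSet k ρ γ)
    (hcells : γhat.cells = γ.cells.filter fun d => ¬ (Removable γ d ∧ residue k d = i)) :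
    IsAffineSVStrip k (r - 1) ρ β γhat := by
  obtain ⟨hr, hρ, hρβ, hργ, hm, haff, hrem, hasv⟩ := h
  have hmem := mem_of_removeCorners hcells
  obtain ⟨hrk, hβ, hγ, hβγ, hsize, hcard⟩ := id haff
  have hiβ : i + 1 ∉ resSet k β γ := fun h => hi' (resSet_mono_left hρβ h)
  have hβhat : β ≤ γhat := fun d hd => (hmem d).2 ⟨hβγ.1 hd, by
    rintro ⟨h1, rfl⟩
    exact haff.notMem_of_removable h1 hi hiβ hd⟩
  have hhat : γhat ≤ γ := fun d hd => ((hmem d).1 hd).1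
  have hres : resSet k β γhat = (resSet k β γ).erase i := by
    ext j
    rw [Finset.mem_erase]
    constructor
    · intro hj
      obtain ⟨d, h1, h2, rfl⟩ := exists_of_mem_resSet hj
      refine ⟨?_, mem_resSet_of_mem (hhat h1) h2⟩
      rintro rfl
      exact ((hmem d).1 h1).2 ⟨hβγ.removable (hhat h1) h2 hiβ, rfl⟩
    · rintro ⟨hne, hj⟩
      obtain ⟨d, h1, h2, rfl⟩ := exists_of_mem_resSet hj
      exact mem_resSet_of_mem ((hmem d).2 ⟨h1, fun h => hne h.2⟩) h2
  have hpos := Finset.card_pos.2 ⟨i, hi⟩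
  have hcard' := Finset.card_erase_of_mem hi
  rw [← hres] at hcard'
  have hex : ∃ d, Removable γ d ∧ residue k d = i := by
    obtain ⟨d, h1, h2, h3⟩ := exists_of_mem_resSet hi
    exact ⟨d, hβγ.removable h1 h2 (h3 ▸ hiβ), h3⟩
  have hp := pSize_removeCorners hk hγ hcells hex
  refine ⟨by omega, hρ, hρβ, hργ.mono le_rfl hhat (hρβ.trans hβhat), by omega,
    ⟨by omega, hβ, isCore_removeCorners hk hγ hcells, hβγ.mono le_rfl hhat hβhat, by omega,
      by omega⟩, hrem, ?_⟩
  intro c hc hc' d hd hdc hblock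
  refine hasv c hc hc' d hd hdc fun hb => hblock ?_
  refine (hmem _).2 ⟨hb, fun ⟨_, h2⟩ => hi' ?_⟩
  have e : i + 1 = residue k c := by
    rw [← hdc, ← h2]
    unfold residue
    push_cast
    ring
  rw [e]
  exact mem_resSet_of_mem (hβγ.1 hc) hc'

theorem IsAffineSVStrip.addCorners {k : ℕ} (hk : 1 ≤ k) {r : ℕ} {ρ ρhat β γ : YoungDiagram}
    (h : IsAffineSVStrip k r ρ β γ) {i : ZMod (k + 1)} (hi : i ∈ resSet k ρ β)
    (hi' : i + 1 ∉ resSet k ρ γ) (hcells : ρhat.cells = ρ.cells ∪ addableSet k i ρ) :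
    IsAffineSVStrip k (r - 1) ρhat β γ := by
  obtain ⟨hr, hρ, hρβ, hργ, hm, haff, hrem, hasv⟩ := h
  have hmem : ∀ d, d ∈ ρhat ↔ d ∈ ρ ∨ Addable ρ d ∧ residue k d = i := by
    intro d
    rw [← YoungDiagram.mem_cells, hcells, Finset.mem_union, mem_addableSet_iff,
      YoungDiagram.mem_cells]
  have hβ := haff.2.1
  have hβγ := haff.2.2.2.1
  have hs : IsHorizontalStrip ρ β := hργ.mono le_rfl hβγ.1 hρβ
  have hiβ : i + 1 ∉ resSet k ρ β := fun h => hi' (resSet_mono_right hβγ.1 h)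
  have hadd : ∀ d, d ∈ β → d ∉ ρ → Addable ρ d := by
    intro d hd hd'
    refine ⟨hd', fun e hle hne => ?_⟩
    by_contra he
    have heβ : e ∈ β := β.isLowerSet hle hd
    obtain ⟨-, h1, h2⟩ := hrem e heβ he
    obtain ⟨hle1, hle2⟩ : e.1 ≤ d.1 ∧ e.2 ≤ d.2 := hle
    rcases hle1.lt_or_eq with hlt | heq
    · exact h1 (β.up_left_mem hlt hle2 hd)
    · rcases hle2.lt_or_eq with hlt | heq'
      · exact h2 (β.up_left_mem hle1 hlt hd)
      · exact hne (Prod.ext heq heq')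
  have hρhat : ρ ≤ ρhat := fun d hd => (hmem d).2 (Or.inl hd)
  have hhatβ : ρhat ≤ β := by
    intro d hd
    rcases (hmem d).1 hd with hd | ⟨hd, hdi⟩
    · exact hρβ hd
    by_contra hdβ
    obtain ⟨c, c1, c2, c3⟩ := exists_of_mem_resSet hi
    have hcont := (intCast_eq_iff k ((d.2 : ℤ) - d.1) ((c.2 : ℤ) - c.1)).1
      (by rw [← residue_eq_intCast, ← residue_eq_intCast, hdi, c3])
    obtain ⟨-, e1, e2⟩ := (removable_iff β c).1 (hrem c c1 c2)
    obtain ⟨e3, e4, e5⟩ := (addable_iff ρ d).1 hd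
    have hdβ' := (mem_iff_lt_rowsFrom β d.1 d.2).not.1 hdβ
    rw [residue_eq_intCast] at hdi
    set t : ℤ := (d.2 : ℤ) - d.1
    set s : ℤ := (c.2 : ℤ) - c.1
    have f1 : stripCount ρ β t = 0 := by
      have := rowsFrom_mono hρβ t
      unfold stripCount
      omega
    have f2 : stripCount ρ β (t + 1) = 0 := by
      rcases hs.stripCount_eq (t + 1) with h0 | h0
      · exact h0
      · exact absurd ((hs.mem_resSet_iff k _).2 ⟨t + 1, h0, by push_cast; rw [← hdi]⟩) hiβ
    have f3 := bead_sub_bead ρ β t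
    have f4 := bead_sub_bead' ρ β t
    have f5 := bead_eq_zero_or_one β (t - 1)
    have f6 := hs.stripCount_eq (t - 1)
    rcases le_total t s with hts | hst
    · have := hβ.bead_eq_one e1 hcont hts
      omega
    · have := hβ.bead_eq_zero (t := t - 1) e2
        (by rw [sub_sub_sub_cancel_right]; exact dvd_sub_comm.1 hcont) (by omega)
      omega
  have hres : resSet k ρhat β = (resSet k ρ β).erase i := by
    ext j
    rw [Finset.mem_erase]
    constructor
    · intro hj
      obtain ⟨d, h1, h2, rfl⟩ := exists_of_mem_resSet hj
      have h3 : d ∉ ρ := fun h => h2 (hρhat h)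
      exact ⟨fun h => h2 ((hmem d).2 (Or.inr ⟨hadd d h1 h3, h⟩)), mem_resSet_of_mem h1 h3⟩
    · rintro ⟨hne, hj⟩
      obtain ⟨d, h1, h2, rfl⟩ := exists_of_mem_resSet hj
      exact mem_resSet_of_mem h1 fun h => ((hmem d).1 h).elim h2 fun h => hne h.2
  have hpos := Finset.card_pos.2 ⟨i, hi⟩
  have hcard' := Finset.card_erase_of_mem hi
  rw [← hres] at hcard'
  refine ⟨by omega, isCore_addCorners hk hρ hcells, hhatβ,
    hργ.mono hρhat le_rfl (hhatβ.trans hβγ.1), by omega, ?_,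
    fun c hc hc' => hrem c hc fun h => hc' (hρhat h), ?_⟩
  · rw [show r - 1 - (resSet k ρhat β).card = r - (resSet k ρ β).card by omega]
    exact haff
  · intro c hc hc' d hd hdc hblock hdhat
    have hcρ : c ∉ ρ := fun h => hc' (hρhat h)
    rcases (hmem d).1 hdhat with h1 | ⟨-, h1⟩
    · exact hasv c hc hcρ d hd hdc hblock h1
    · exact hc' ((hmem c).2 (Or.inr ⟨hadd c hc hcρ, hdc ▸ h1⟩))

/-- Let `(γ/β, ρ)` be an affine set-valued strip and let `i` be the residue of
the rightmost cell of `γ/ρ`.  If `i ∈ Res(γ/β)`, then `(γ̂/β, ρ)` is an affine set-valued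
strip, where `γ̂` is `γ` with all its removable `i`-corners deleted.  Otherwise, `(γ/β, ρ̂)` is
an affine set-valued strip, where `ρ̂` is `ρ` together with all its addable `i`-corners. -/
theorem affineSVStrip_iterate
    (k : ℕ) (hk : 1 ≤ k) (r : ℕ) (ρ β γ : YoungDiagram)
    (h : IsAffineSVStrip k r ρ β γ) (i : ZMod (k + 1)) (c : ℕ × ℕ)
    (hcγ : c ∈ γ) (hcρ : c ∉ ρ) (hres : residue k c = i)
    (hrightmost : ∀ d : ℕ × ℕ, d ∈ γ → d ∉ ρ → d.2 ≤ c.2) :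
    (i ∈ resSet k β γ →
      ∀ γhat : YoungDiagram,
        γhat.cells = (γ.cells.filter fun d => ¬ (Removable γ d ∧ residue k d = i)) →
        ∃ r' : ℕ, IsAffineSVStrip k r' ρ β γhat) ∧
    (i ∉ resSet k β γ →
      ∀ ρhat : YoungDiagram, ρhat.cells = ρ.cells ∪ addableSet k i ρ →
        ∃ r' : ℕ, IsAffineSVStrip k r' ρhat β γ) := by
  have hγ := h.2.2.2.2.2.1.2.2.1
  have hnext : i + 1 ∉ resSet k ρ γ := by
    rw [← hres]
    exact h.2.2.2.1.residue_rightmost_succ hγ hcγ hcρ hrightmost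
  refine ⟨fun hi γhat hcells => ⟨r - 1, h.removeCorners hk hi hnext hcells⟩,
    fun hi ρhat hcells => ⟨r - 1, h.addCorners hk ?_ hnext hcells⟩⟩
  have hcβ : c ∈ β := by
    by_contra hcβ
    exact hi (hres ▸ mem_resSet_of_mem hcγ hcβ)
  exact hres ▸ mem_resSet_of_mem hcβ hcρ

end AffineKTheory
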